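/- arXiv:2601.10409 — 2 statements merged into one kernel-verified Lean document; each statement's English description precedes it below -/
import Mathlib

section
/- Let (X, d) be a metric space and let (φ_t)_{t ∈ ℝ} be a one-parameter group of bijections of X (φ_0 = id and φ_{s+t} = φ_s ∘ φ_t) such that each φ_t preserves the distance d. Let x₀ ∈ X be such that t ↦ φ_t(x₀) is continuous, let ε > 0, and let N ≥ 1 be a natural number such that every subset of X of cardinality N + 1 contains two distinct points at distance strictly less than ε. Assume the set E = {t > 0 : d(x₀, φ_t(x₀)) ≥ ε} is nonempty and let t_exit = sInf E. Then there exists t with t_exit < t ≤ N · t_exit such that d(x₀, φ_t(x₀)) < ε; in particular the first recurrence time t_rec = sInf{t > t_exit : d(x₀, φ_t(x₀)) ≤ ε} satisfies t_rec ≤ N · t_exit. -/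
/-- For a distance-preserving one-parameter group `φ` on a metric
space whose `ε`-packing number is at most `N`, the first recurrence time of a
continuous trajectory started at `x₀` is at most `N` times the exit time. -/
theorem stmt_1 {X : Type*} [MetricSpace X] (φ : ℝ → X → X)
    (hφ0 : φ 0 = id) (hφ_add : ∀ s t : ℝ, φ (s + t) = φ s ∘ φ t)
    (hφ_iso : ∀ (t : ℝ) (x y : X), dist (φ t x) (φ t y) = dist x y)
    (x₀ : X) (hcont : Continuous fun t : ℝ => φ t x₀)
    (ε : ℝ) (hε : 0 < ε) (N : ℕ) (hN : 1 ≤ N)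
    (hpack : ∀ S : Finset X, S.card = N + 1 →
      ∃ x ∈ S, ∃ y ∈ S, x ≠ y ∧ dist x y < ε)
    (hE : {t : ℝ | 0 < t ∧ ε ≤ dist x₀ (φ t x₀)}.Nonempty)
    (texit : ℝ) (htexit : texit = sInf {t : ℝ | 0 < t ∧ ε ≤ dist x₀ (φ t x₀)}) :
    (∃ t : ℝ, texit < t ∧ t ≤ (N : ℝ) * texit ∧ dist x₀ (φ t x₀) < ε) ∧
      sInf {t : ℝ | texit < t ∧ dist x₀ (φ t x₀) ≤ ε} ≤ (N : ℝ) * texit := by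
  have hcd : Continuous fun t : ℝ => dist x₀ (φ t x₀) := continuous_const.dist hcont
  have hset : {t : ℝ | 0 < t ∧ ε ≤ dist x₀ (φ t x₀)}
      = {t : ℝ | 0 ≤ t ∧ ε ≤ dist x₀ (φ t x₀)} := by
    ext t
    simp only [Set.mem_setOf_eq]
    constructor
    · rintro ⟨h1, h2⟩
      exact ⟨h1.le, h2⟩
    · rintro ⟨h1, h2⟩
      refine ⟨lt_of_le_of_ne h1 ?_, h2⟩
      rintro rfl
      rw [hφ0] at h2
      simp at h2
      linarith
  have hclosed : IsClosed {t : ℝ | 0 < t ∧ ε ≤ dist x₀ (φ t x₀)} := by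
    rw [hset]
    exact (isClosed_le continuous_const continuous_id).inter
      (isClosed_le continuous_const hcd)
  have hbdd : BddBelow {t : ℝ | 0 < t ∧ ε ≤ dist x₀ (φ t x₀)} := ⟨0, fun t ht => ht.1.le⟩
  have hmem := hclosed.csInf_mem hE hbdd
  rw [← htexit] at hmem
  obtain ⟨hT, hTε⟩ := hmem
  have hdist : ∀ s t : ℝ, dist (φ s x₀) (φ t x₀) = dist x₀ (φ (t - s) x₀) := by
    intro s t
    have h : φ t x₀ = φ s (φ (t - s) x₀) := by
      have := congrFun (hφ_add s (t - s)) x₀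
      rw [add_sub_cancel] at this
      exact this
    rw [h, hφ_iso]
  have hpair : ∃ i j : ℕ, i < j ∧ j ≤ N ∧
      dist (φ ((i : ℝ) * texit) x₀) (φ ((j : ℝ) * texit) x₀) < ε := by
    have key : ∃ i j : ℕ, i ≠ j ∧ i ≤ N ∧ j ≤ N ∧
        dist (φ ((i : ℝ) * texit) x₀) (φ ((j : ℝ) * texit) x₀) < ε := by
      classical
      by_cases hinj : Set.InjOn (fun k : ℕ => φ ((k : ℝ) * texit) x₀)
          (Finset.range (N + 1) : Set ℕ)
      · obtain ⟨x, hx, y, hy, hne, hlt⟩ := hpack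
          ((Finset.range (N + 1)).image (fun k : ℕ => φ ((k : ℝ) * texit) x₀))
          (by rw [Finset.card_image_of_injOn hinj, Finset.card_range])
        obtain ⟨i, hi, rfl⟩ := Finset.mem_image.1 hx
        obtain ⟨j, hj, rfl⟩ := Finset.mem_image.1 hy
        rw [Finset.mem_range] at hi hj
        exact ⟨i, j, fun h => hne (by rw [h]), by omega, by omega, hlt⟩
      · unfold Set.InjOn at hinj
        push Not at hinj
        obtain ⟨i, hi, j, hj, heq, hne⟩ := hinj
        rw [Finset.mem_coe, Finset.mem_range] at hi hj
        refine ⟨i, j, hne, by omega, by omega, ?_⟩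
        have heq' : φ ((i : ℝ) * texit) x₀ = φ ((j : ℝ) * texit) x₀ := heq
        rw [heq', dist_self]
        exact hε
    obtain ⟨i, j, hne, hi, hj, h⟩ := key
    rcases lt_or_gt_of_ne hne with hlt | hlt
    · exact ⟨i, j, hlt, hj, h⟩
    · exact ⟨j, i, hlt, hi, by rwa [dist_comm]⟩
  have hfirst : ∃ t : ℝ, texit < t ∧ t ≤ (N : ℝ) * texit ∧ dist x₀ (φ t x₀) < ε := by
    obtain ⟨i, j, hij, hj, h⟩ := hpair
    rw [hdist] at h
    obtain ⟨m, rfl⟩ := Nat.exists_eq_add_of_lt hij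
    have he : ((i + m + 1 : ℕ) : ℝ) * texit - (i : ℝ) * texit = ((m : ℝ) + 1) * texit := by
      push_cast
      ring
    rw [he] at h
    have hm : m ≠ 0 := by
      rintro rfl
      simp at h
      linarith
    have hm1 : (1 : ℝ) ≤ m := by exact_mod_cast Nat.one_le_iff_ne_zero.2 hm
    have hmN : (m : ℝ) + 1 ≤ N := by exact_mod_cast (by omega : m + 1 ≤ N)
    exact ⟨((m : ℝ) + 1) * texit, by nlinarith, by gcongr, h⟩
  refine ⟨hfirst, ?_⟩
  obtain ⟨t, h1, h2, h3⟩ := hfirst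
  have hb : BddBelow {t : ℝ | texit < t ∧ dist x₀ (φ t x₀) ≤ ε} :=
    ⟨texit, fun s hs => hs.1.le⟩
  have hm : t ∈ {t : ℝ | texit < t ∧ dist x₀ (φ t x₀) ≤ ε} := ⟨h1, h3.le⟩
  exact (csInf_le hb hm).trans h2
end

section
/- Let (X, d) be a metric space and let φ : X → X be a bijective isometry. Let ε > 0 and let N ≥ 1 be a natural number such that every subset of X of cardinality N + 1 contains two distinct points at distance strictly less than ε/2 (i.e. the (ε/2)-packing number of X is at most N). Then for every x₀ ∈ X and every natural number k ≥ 1 there exist natural numbers 0 < i₁ < i₂ < ⋯ < i_k ≤ k·N such that d(x₀, φ^[i_j](x₀)) < ε for every j = 1, …, k. -/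
/-- Pigeonhole step for subsequent recurrences: if `φ` is a
bijective isometry of a metric space whose `ε/2`-packing number is at most `N`,
then among the first `k·N` iterates of any point `x₀` one can find `k` iterates
(with strictly increasing positive indices) all lying within distance `ε` of `x₀`. -/
theorem stmt_2 {X : Type*} [MetricSpace X] (φ : X → X)
    (hφ_bij : Function.Bijective φ) (hφ_iso : Isometry φ)
    (ε : ℝ) (hε : 0 < ε) (N : ℕ) (hN : 1 ≤ N)
    (hpack : ∀ S : Finset X, S.card = N + 1 →
      ∃ x ∈ S, ∃ y ∈ S, x ≠ y ∧ dist x y < ε / 2) :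
    ∀ x₀ : X, ∀ k : ℕ, 1 ≤ k →
      ∃ i : Fin k → ℕ, StrictMono i ∧ (∀ j, 0 < i j) ∧ (∀ j, i j ≤ k * N) ∧
        ∀ j, dist x₀ (φ^[i j] x₀) < ε := by
  classical
  intro x₀ k hk
  have hd : ∀ a m, dist (φ^[a] x₀) (φ^[a + m] x₀) = dist x₀ (φ^[m] x₀) := by
    intro a m
    rw [Function.iterate_add_apply]
    generalize φ^[m] x₀ = y
    induction a with
    | zero => rfl
    | succ a ih =>
      rw [Function.iterate_succ_apply', Function.iterate_succ_apply', hφ_iso.dist_eq, ih]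
  let P : Finset ℕ → Prop := fun A =>
    ∀ a ∈ A, ∀ b ∈ A, a ≠ b → ε / 2 ≤ dist (φ^[a] x₀) (φ^[b] x₀)
  let R := Finset.range (k * N + 1)
  obtain ⟨A, hA, hmax⟩ := Finset.exists_max_image (R.powerset.filter P) Finset.card
    ⟨∅, by simp [P]⟩
  rw [Finset.mem_filter, Finset.mem_powerset] at hA
  obtain ⟨hAR, hAP⟩ := hA
  have hcard : A.card ≤ N := by
    by_contra! hlt
    obtain ⟨B, hBA, hB⟩ := Finset.exists_subset_card_eq (show N + 1 ≤ A.card from hlt)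
    have hinj : Set.InjOn (fun a => φ^[a] x₀) (B : Set ℕ) := by
      intro a ha b hb hab
      by_contra hne
      have h1 := hAP a (hBA ha) b (hBA hb) hne
      have h2 : dist (φ^[a] x₀) (φ^[b] x₀) = 0 := by
        rw [dist_eq_zero]; exact hab
      linarith
    obtain ⟨x, hx, y, hy, hxy, hlt'⟩ := hpack (B.image fun a => φ^[a] x₀)
      (by rw [Finset.card_image_of_injOn hinj, hB])
    obtain ⟨a, ha, rfl⟩ := Finset.mem_image.1 hx
    obtain ⟨b, hb, rfl⟩ := Finset.mem_image.1 hy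
    have hne : a ≠ b := fun h => hxy (by rw [h])
    have := hAP a (hBA ha) b (hBA hb) hne
    linarith
  have hcov : ∀ n ∈ R, ∃ a ∈ A, dist (φ^[n] x₀) (φ^[a] x₀) < ε / 2 := by
    intro n hn
    by_contra! hfar
    have hnA : n ∉ A := by
      intro h
      have := hfar n h
      rw [dist_self] at this
      linarith
    have hmem : insert n A ∈ R.powerset.filter P := by
      rw [Finset.mem_filter, Finset.mem_powerset]
      refine ⟨Finset.insert_subset hn hAR, ?_⟩
      intro a ha b hb hab
      rcases Finset.mem_insert.1 ha with rfl | ha'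
      · rcases Finset.mem_insert.1 hb with rfl | hb
        · exact absurd rfl hab
        · exact hfar b hb
      · rcases Finset.mem_insert.1 hb with rfl | hb
        · rw [dist_comm]; exact hfar a ha'
        · exact hAP a ha' b hb hab
    have := hmax _ hmem
    rw [Finset.card_insert_of_notMem hnA] at this
    omega
  choose! f hfA hf using hcov
  have hlt : A.card * k < R.card := by
    have := Nat.mul_le_mul_right k hcard
    simp only [R, Finset.card_range]
    rw [Nat.mul_comm k N]
    omega
  obtain ⟨c, hc, hck⟩ := Finset.exists_lt_card_fiber_of_mul_lt_card_of_maps_to hfA hlt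
  set F := R.filter (fun n => f n = c) with hF
  have hne : F.Nonempty := Finset.card_pos.1 (by omega)
  set m := F.min' hne with hm
  have hmF : m ∈ F := F.min'_mem hne
  obtain ⟨G, hGF, hG⟩ := Finset.exists_subset_card_eq
    (show k ≤ (F.erase m).card by rw [Finset.card_erase_of_mem hmF]; omega)
  have hgt : ∀ n ∈ G, m < n := fun n hn => F.min'_lt_of_mem_erase_min' hne (hGF hn)
  have hmono := (G.orderEmbOfFin hG).strictMono
  have hmem : ∀ j, G.orderEmbOfFin hG j ∈ G := fun j => G.orderEmbOfFin_mem hG j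
  refine ⟨fun j => G.orderEmbOfFin hG j - m, ?_, ?_, ?_, ?_⟩
  · intro a b hab
    have h1 := hmono hab
    have h2 := hgt _ (hmem a)
    show _ - m < _ - m
    omega
  · intro j
    have := hgt _ (hmem j)
    show 0 < _ - m
    omega
  · intro j
    have h1 := (Finset.mem_filter.1 (Finset.mem_of_mem_erase (hGF (hmem j)))).1
    have h2 := Finset.mem_range.1 h1
    show _ - m ≤ _
    omega
  · intro j
    have h1 := Finset.mem_filter.1 (Finset.mem_of_mem_erase (hGF (hmem j)))
    have h2 := Finset.mem_filter.1 hmF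
    have h3 := hf _ h1.1
    have h4 := hf _ h2.1
    rw [h1.2] at h3
    rw [h2.2] at h4
    have h5 := dist_triangle_right (φ^[m] x₀) (φ^[G.orderEmbOfFin hG j] x₀) (φ^[c] x₀)
    have h6 := hd m (G.orderEmbOfFin hG j - m)
    rw [Nat.add_sub_cancel' (hgt _ (hmem j)).le] at h6
    show dist x₀ (φ^[G.orderEmbOfFin hG j - m] x₀) < ε
    linarith
end
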